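/- Let λ > 0, let K ≥ 2 be an integer, and let 0 < R_min < R_max be reals. Define, for x ∈ (R_min/R_max, 1), F(x) = (1/(K−1)!) · [ ∫_{λπ(1/x² − 1) R_min²}^{λπ(R_max² − R_min²)} e^{−u} u^{K−1} du − e^{λπ R_min²} (1 − x²)^{K−1} ∫_{λπ R_min²/x²}^{λπ R_max²} e^{−t} t^{K−1} dt ]. Then F has derivative at every x ∈ (R_min/R_max, 1) equal to f(x) = (2 e^{λπ R_min²} x (1 − x²)^{K−2} / (K−2)!) · [ Γ(K, λπ R_min²/x²) − Γ(K, λπ R_max²) ], where Γ(a, y) = ∫_y^∞ t^{a−1} e^{−t} dt denotes the upper incomplete gamma function. (f is, up to the normalizing constant P[Φ(𝒜) ≥ K], the probability density of the relative distance δ = ‖d₁‖/‖d_K‖ in Lemma 5.) -/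

import Mathlib

open Real Finset intervalIntegral MeasureTheory

/-- The integrand of the gamma function with natural exponent is integrable on `(y, ∞)`. -/
lemma integrableOn_Ioi_pow_mul_exp_neg (n : ℕ) {y : ℝ} (hy : 0 ≤ y) :
    IntegrableOn (fun t : ℝ => t ^ n * Real.exp (-t)) (Set.Ioi y) := by
  have h := Real.GammaIntegral_convergent (s := (n : ℝ) + 1) (by positivity)
  refine IntegrableOn.mono_set ?_ (Set.Ioi_subset_Ioi hy)
  refine h.congr_fun (fun t _ => ?_) measurableSet_Ioi
  simp only [add_sub_cancel_right, Real.rpow_natCast]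
  exact mul_comm _ _

/-- A difference of upper incomplete gamma functions is an integral over an interval. -/
lemma integral_Ioi_pow_mul_exp_neg_sub (n : ℕ) {y z : ℝ} (hy : 0 ≤ y) (hz : 0 ≤ z) :
    (∫ t in Set.Ioi y, t ^ n * Real.exp (-t)) - ∫ t in Set.Ioi z, t ^ n * Real.exp (-t) =
      ∫ t in y..z, Real.exp (-t) * t ^ n := by
  rw [integral_Ioi_sub_Ioi' (integrableOn_Ioi_pow_mul_exp_neg n hy)
    (integrableOn_Ioi_pow_mul_exp_neg n hz)]
  simp only [mul_comm]

/-- The fundamental theorem of calculus for a variable lower limit, with the chain rule. -/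
lemma HasDerivAt.integral_left_of_continuous {g u : ℝ → ℝ} {u' x : ℝ} (hg : Continuous g)
    (hu : HasDerivAt u u' x) (b : ℝ) :
    HasDerivAt (fun y => ∫ t in u y..b, g t) (-g (u x) * u') x :=
  (integral_hasDerivAt_left (hg.intervalIntegrable _ _)
    (hg.stronglyMeasurableAtFilter _ _) hg.continuousAt).comp x hu

/-- Lemma 5 of the paper, density of the relative distance `δ = ‖d₁‖/‖d_K‖`:
the (unnormalized) CDF `F` has derivative at every `x ∈ (R_min/R_max, 1)`
equal to `f(x) = (2 e^{λπR_min²} x (1−x²)^{K−2}/(K−2)!)·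
(Γ(K, λπR_min²/x²) − Γ(K, λπR_max²))`, where `Γ(K, y) = ∫_y^∞ t^{K−1} e^{−t} dt`
is the upper incomplete gamma function. -/
theorem relative_distance_density
    (lam : ℝ) (hlam : 0 < lam) (K : ℕ) (hK : 2 ≤ K)
    (Rmin Rmax : ℝ) (hRmin : 0 < Rmin) (hR : Rmin < Rmax)
    (Γinc : ℝ → ℝ)
    (hΓ : ∀ y, Γinc y = ∫ t in Set.Ioi y, t ^ (K - 1) * Real.exp (-t))
    (F f : ℝ → ℝ)
    (hF : ∀ x, F x = (1 / ((K - 1).factorial : ℝ)) *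
        ((∫ u in (lam * π * (1 / x ^ 2 - 1) * Rmin ^ 2)..(lam * π * (Rmax ^ 2 - Rmin ^ 2)),
            Real.exp (-u) * u ^ (K - 1)) -
          Real.exp (lam * π * Rmin ^ 2) * (1 - x ^ 2) ^ (K - 1) *
            ∫ t in (lam * π * Rmin ^ 2 / x ^ 2)..(lam * π * Rmax ^ 2),
              Real.exp (-t) * t ^ (K - 1)))
    (hf : ∀ x, f x = 2 * Real.exp (lam * π * Rmin ^ 2) * x * (1 - x ^ 2) ^ (K - 2) /
        ((K - 2).factorial : ℝ) *
        (Γinc (lam * π * Rmin ^ 2 / x ^ 2) - Γinc (lam * π * Rmax ^ 2))) :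
    ∀ x ∈ Set.Ioo (Rmin / Rmax) 1, HasDerivAt F (f x) x := by
  intro x hx
  have hx0 : 0 < x := (div_pos hRmin (hRmin.trans hR)).trans hx.1
  obtain ⟨m, rfl⟩ := Nat.exists_eq_add_of_le' hK
  have hg : Continuous fun t : ℝ => Real.exp (-t) * t ^ (m + 1) := by fun_prop
  set a := lam * π * Rmin ^ 2 with ha
  have ha0 : 0 < a := by positivity
  have hd0 : 0 ≤ lam * π * Rmax ^ 2 := by positivity
  have hinv : HasDerivAt (fun y : ℝ => a / y ^ 2) (-2 * a / x ^ 3) x := by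
    refine ((hasDerivAt_const x a).div (hasDerivAt_pow 2 x) (by positivity)).congr_deriv ?_
    push_cast
    field_simp
    ring
  have hlow : HasDerivAt (fun y : ℝ => lam * π * (1 / y ^ 2 - 1) * Rmin ^ 2)
      (-2 * a / x ^ 3) x := by
    refine (hinv.sub_const a).congr_of_eventuallyEq (Filter.Eventually.of_forall fun y => ?_)
    simp only [ha]
    ring
  have hpow : HasDerivAt (fun y : ℝ => (1 - y ^ 2) ^ (m + 1))
      ((m + 1) * (1 - x ^ 2) ^ m * (-2 * x)) x := by
    refine (((hasDerivAt_pow 2 x).const_sub 1).pow (m + 1)).congr_deriv ?_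
    simp
  have hlow_eq : lam * π * (1 / x ^ 2 - 1) * Rmin ^ 2 = a / x ^ 2 * (1 - x ^ 2) := by
    rw [ha]
    field_simp
  have hexp : Real.exp (-(a / x ^ 2 * (1 - x ^ 2))) = Real.exp a * Real.exp (-(a / x ^ 2)) := by
    rw [← Real.exp_add]
    congr 1
    field_simp
    ring
  have hderiv := ((hlow.integral_left_of_continuous hg (lam * π * (Rmax ^ 2 - Rmin ^ 2))).sub
    ((hpow.const_mul (Real.exp a)).mul
      (hinv.integral_left_of_continuous hg (lam * π * Rmax ^ 2)))).const_mul
        (1 / ((m + 1).factorial : ℝ))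
  rw [show F = _ from funext hF]
  refine hderiv.congr_deriv ?_
  rw [hf, hΓ, hΓ]
  simp only [show m + 2 - 1 = m + 1 from rfl, Nat.add_sub_cancel]
  rw [integral_Ioi_pow_mul_exp_neg_sub (m + 1) (by positivity) hd0, hlow_eq, hexp,
    Nat.factorial_succ]
  push_cast
  rw [mul_pow (a / x ^ 2)]
  generalize (∫ t in (a / x ^ 2)..(lam * π * Rmax ^ 2), Real.exp (-t) * t ^ (m + 1)) = J
  have hm : (m.factorial : ℝ) ≠ 0 := by positivity
  have hm1 : (m : ℝ) + 1 ≠ 0 := by positivity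
  generalize Real.exp (-(a / x ^ 2)) = E
  generalize (a / x ^ 2) ^ (m + 1) = P
  field_simp
  ring
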